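/- Let d ≥ 1, m ∈ ℝ, 1 < q < ∞, and s ≤ 0. Then there exists a symbol a ∈ S^m_{1,1} such that for every constant C > 0 there is a Schwartz function f with ‖T_a f‖_{F_∞^{s,q}} > C ‖f‖_{F_∞^{s+m,q}}; that is, T_a is unbounded from F_∞^{s+m,q} to F_∞^{s,q}. Hence the condition s > τ_q = 0 for F_∞-boundedness of operators in OpS^m_{1,1} is sharp in the range 1 < q < ∞. -/

import Mathlib

noncomputable section

open MeasureTheory SchwartzMap Complex RealInnerProductSpace Filter
open scoped ENNReal NNReal ContDiff SchwartzMap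

/-- Euclidean space `ℝ^d`. -/
abbrev RD (d : ℕ) : Type := EuclideanSpace ℝ (Fin d)

/-- Tempered distributions on `ℝ^d`. -/
abbrev TD (d : ℕ) : Type := 𝓢(RD d, ℂ) →L[ℂ] ℂ

/-- Fourier transform of a Schwartz function (with the convention
`f̂(ξ) = ∫ f(x) e^{-2πi⟨x,ξ⟩} dx`). -/
def fourierS {d : ℕ} (f : 𝓢(RD d, ℂ)) : 𝓢(RD d, ℂ) :=
  SchwartzMap.fourierTransformCLM ℂ f

/-- Hörmander symbol class `S^m_{1,1}`: `a` is smooth and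
`‖∂_ξ^α ∂_x^β a(x,ξ)‖ ≤ c_{α,β} (1+‖ξ‖)^{m-|α|+|β|}` for all orders of derivatives. -/
def IsSymbolS11 (d : ℕ) (m : ℝ) (a : RD d → RD d → ℂ) : Prop :=
  ContDiff ℝ ∞ (fun p : RD d × RD d => a p.1 p.2) ∧
  ∀ α β : ℕ, ∃ c : ℝ, ∀ x ξ : RD d,
    ‖iteratedFDeriv ℝ α (fun ξ' => iteratedFDeriv ℝ β (fun x' => a x' ξ') x) ξ‖
      ≤ c * (1 + ‖ξ‖) ^ (m - (α : ℝ) + (β : ℝ))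

/-- The pseudo-differential operator `T_a f(x) = ∫ a(x,ξ) f̂(ξ) e^{2πi⟨x,ξ⟩} dξ`
acting on a Schwartz function `f`. -/
def pdo {d : ℕ} (a : RD d → RD d → ℂ) (f : 𝓢(RD d, ℂ)) (x : RD d) : ℂ :=
  ∫ ξ, a x ξ * fourierS f ξ * Complex.exp (2 * Real.pi * Complex.I * ((⟪x, ξ⟫ : ℝ) : ℂ))

/-- Littlewood–Paley data: a Schwartz function `φ` with `φ̂` supported in
`{1/2 ≤ |ξ| ≤ 2}` and `Σ_{k∈ℤ} φ̂(2^{-k}ξ) = 1` for `ξ ≠ 0`, together with the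
low-frequency piece `Φ` determined by `Φ̂ = 1 - Σ_{k≥1} φ̂(2^{-k}·)`. -/
structure LPData (d : ℕ) where
  φ : 𝓢(RD d, ℂ)
  Φ : 𝓢(RD d, ℂ)
  supp_φ : ∀ ξ : RD d, fourierS φ ξ ≠ 0 → 1/2 ≤ ‖ξ‖ ∧ ‖ξ‖ ≤ 2
  sum_φ : ∀ ξ : RD d, ξ ≠ 0 → HasSum (fun k : ℤ => fourierS φ ((2:ℝ)^(-k) • ξ)) 1
  Φ_def : ∀ ξ : RD d, fourierS Φ ξ = 1 - ∑' k : ℕ, fourierS φ (((2:ℝ)^(k+1))⁻¹ • ξ)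

/-- The Littlewood–Paley convolution kernel: `Φ` for `k = 0` and
`φ_k = 2^{kd} φ(2^k ·)` for `k ≥ 1`. -/
def LPkernel {d : ℕ} (D : LPData d) : ℕ → RD d → ℂ
  | 0, x => D.Φ x
  | (k+1), x => (((2:ℝ)^((k+1) * d) : ℝ) : ℂ) * D.φ ((2:ℝ)^(k+1) • x)

/-- The Fourier transform of the `k`-th Littlewood–Paley kernel, i.e. `φ̂_k = φ̂(2^{-k}·)`
for `k ≥ 1` and `Φ̂` for `k = 0`. -/
def LPhat {d : ℕ} (D : LPData d) : ℕ → RD d → ℂ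
  | 0, ξ => fourierS D.Φ ξ
  | (k+1), ξ => fourierS D.φ (((2:ℝ)^(k+1))⁻¹ • ξ)

/-- Littlewood–Paley operator `Π_k g = φ_k ∗ g` (with `φ_0 := Φ`) acting on functions. -/
def LP {d : ℕ} (D : LPData d) (k : ℕ) (g : RD d → ℂ) (x : RD d) : ℂ :=
  ∫ y, LPkernel D k y * g (x - y)

/-- `Π*_k = Π_{k-1} + Π_k + Π_{k+1}` (with the convention `φ_{-1} := 0`). -/
def LPstar {d : ℕ} (D : LPData d) (k : ℕ) (g : RD d → ℂ) (x : RD d) : ℂ :=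
  (if k = 0 then 0 else LP D (k-1) g x) + LP D k g x + LP D (k+1) g x

open Classical in
/-- Pairing of a tempered distribution with a plain function: it gives `u ψ` if the
function is (the coercion of) a Schwartz function `ψ`, and `0` otherwise. -/
def pairing {d : ℕ} (u : TD d) (g : RD d → ℂ) : ℂ :=
  if h : ∃ ψ : 𝓢(RD d, ℂ), ⇑ψ = g then u h.choose else 0

/-- Fourier transform of a tempered distribution, `⟨û, ψ⟩ = ⟨u, ψ̂⟩`. -/
def fourierTD {d : ℕ} (u : TD d) : TD d :=
  u.comp (SchwartzMap.fourierTransformCLM ℂ)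

/-- Littlewood–Paley operator on tempered distributions:
`Π_k u (x) = ⟨u, φ_k(x - ·)⟩`. -/
def LPdist {d : ℕ} (D : LPData d) (k : ℕ) (u : TD d) (x : RD d) : ℂ :=
  pairing u (fun y => LPkernel D k (x - y))

/-- The symbol `a_{j,k}(x,ξ) = (φ_j ∗ a(·,ξ))(x) · φ̂_k(ξ)` (with `Φ` replacing `φ_0`). -/
def symbolPiece {d : ℕ} (D : LPData d) (a : RD d → RD d → ℂ) (j k : ℕ)
    (x ξ : RD d) : ℂ :=
  (∫ y, LPkernel D j y * a (x - y) ξ) * LPhat D k ξ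

/-- `T_{a_{j,k}} u (x) = ⟨û, a_{j,k}(x,·) e^{2πi⟨x,·⟩}⟩` for a tempered distribution `u`. -/
def pdoPieceD {d : ℕ} (D : LPData d) (a : RD d → RD d → ℂ) (j k : ℕ)
    (u : TD d) (x : RD d) : ℂ :=
  pairing (fourierTD u)
    (fun ξ => symbolPiece D a j k x ξ * Complex.exp (2 * Real.pi * Complex.I * ((⟪x, ξ⟫ : ℝ) : ℂ)))

/-- Partial sums `Σ_{j=0}^N Σ_{k=0}^N T_{a_{j,k}} u (x)`. -/
def pdoPartial {d : ℕ} (D : LPData d) (a : RD d → RD d → ℂ) (N : ℕ)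
    (u : TD d) (x : RD d) : ℂ :=
  ∑ j ∈ Finset.range (N+1), ∑ k ∈ Finset.range (N+1), pdoPieceD D a j k u x

/-- `T_a u` converges in `S'` to the tempered distribution `Tf`: the partial sums
`Σ_{j,k≤N} T_{a_{j,k}} u` (which are functions) converge to `Tf` weakly. -/
def ConvergesInSPrime {d : ℕ} (D : LPData d) (a : RD d → RD d → ℂ)
    (u : TD d) (Tf : TD d) : Prop :=
  ∀ ψ : 𝓢(RD d, ℂ),
    Tendsto (fun N => ∫ x, pdoPartial D a N u x * ψ x) atTop (nhds (Tf ψ))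

/-- The dyadic cube of level `ν` (side length `2^{-ν}`) indexed by `n ∈ ℤ^d`. -/
def dyadicCube (d : ℕ) (ν : ℤ) (n : Fin d → ℤ) : Set (RD d) :=
  {x | ∀ i, (n i : ℝ) * (2:ℝ)^(-ν) ≤ x i ∧ x i < ((n i : ℝ) + 1) * (2:ℝ)^(-ν)}

/-- The local quantity `(|P|⁻¹ ∫_P Σ_{k=k₀}^∞ 2^{skq} ‖g_k(x)‖^q dx)^{1/q}` for the
dyadic cube `P` of level `μ` indexed by `n` (so that `|P|⁻¹ = 2^{μd}`). -/
def cubePiece (d : ℕ) (μ : ℕ) (n : Fin d → ℤ) (k₀ : ℕ) (s q : ℝ)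
    (g : ℕ → RD d → ℂ) : ℝ≥0∞ :=
  ((2:ℝ≥0∞)^((μ:ℝ)*(d:ℝ)) *
    ∫⁻ x in dyadicCube d μ n,
      ∑' j : ℕ, (2:ℝ≥0∞)^(s*((k₀:ℝ)+(j:ℝ))*q) * (‖g (k₀+j) x‖₊ : ℝ≥0∞)^q) ^ (1/q)

/-- The `F_∞^{s,q}` norm (for `q < ∞`) of a function, computed from its
Littlewood–Paley pieces:
`‖Π_0 g‖_∞ + sup_{l(P)<1 dyadic} (|P|⁻¹ ∫_P Σ_{k=-log₂ l(P)}^∞ 2^{skq}|Π_k g|^q)^{1/q}`. -/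
def FinftyNormFun {d : ℕ} (D : LPData d) (s q : ℝ) (g : RD d → ℂ) : ℝ≥0∞ :=
  (⨆ x : RD d, (‖LP D 0 g x‖₊ : ℝ≥0∞)) +
  ⨆ (μ : ℕ) (_ : 1 ≤ μ) (n : Fin d → ℤ),
    cubePiece d μ n μ s q (fun k x => LP D k g x)

/-- The `F_∞^{s,q}` norm (for `q < ∞`) of a tempered distribution. -/
def FinftyNormDist {d : ℕ} (D : LPData d) (s q : ℝ) (u : TD d) : ℝ≥0∞ :=
  (⨆ x : RD d, (‖LPdist D 0 u x‖₊ : ℝ≥0∞)) +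
  ⨆ (μ : ℕ) (_ : 1 ≤ μ) (n : Fin d → ℤ),
    cubePiece d μ n μ s q (fun k x => LPdist D k u x)

/-- The (axis-parallel, closed) cube with corner `c` and side length `L`. -/
def cube (d : ℕ) (c : RD d) (L : ℝ) : Set (RD d) :=
  {x | ∀ i, c i ≤ x i ∧ x i ≤ c i + L}

/-- The average of `g` over the cube with corner `c` and side length `L`. -/
def cubeMean {d : ℕ} (c : RD d) (L : ℝ) (g : RD d → ℂ) : ℂ :=
  (L^d)⁻¹ • ∫ x in cube d c L, g x

/-- The `bmo` norm (local BMO):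
`sup_{l(Q)≥1} |Q|⁻¹∫_Q |g| + sup_{l(Q)<1} |Q|⁻¹∫_Q |g - g_Q|`, over all cubes `Q`. -/
def bmoNorm (d : ℕ) (g : RD d → ℂ) : ℝ≥0∞ :=
  (⨆ (c : RD d) (L : ℝ) (_ : 1 ≤ L),
    ENNReal.ofReal ((L^d)⁻¹) * ∫⁻ x in cube d c L, (‖g x‖₊ : ℝ≥0∞)) +
  (⨆ (c : RD d) (L : ℝ) (_ : 0 < L) (_ : L < 1),
    ENNReal.ofReal ((L^d)⁻¹) * ∫⁻ x in cube d c L, (‖g x - cubeMean c L g‖₊ : ℝ≥0∞))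

/-- The Peetre maximal function `𝔐_{σ,R} g(x) = sup_y ‖g(x-y)‖/(1+R‖y‖)^σ`. -/
def peetre {d : ℕ} (σ R : ℝ) (g : RD d → ℂ) (x : RD d) : ℝ≥0∞ :=
  ⨆ y : RD d, (‖g (x - y)‖₊ : ℝ≥0∞) / ENNReal.ofReal ((1 + R * ‖y‖) ^ σ)

/-- `g` has (distributional) Fourier support contained in `K`: the pairing
`⟨ĝ, ψ⟩ = ∫ g · ψ̂` vanishes for every Schwartz `ψ` whose support does not meet `K`. -/
def HasFourierSupportIn {d : ℕ} (g : RD d → ℂ) (K : Set (RD d)) : Prop :=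
  ∀ ψ : 𝓢(RD d, ℂ), tsupport ⇑ψ ∩ K = ∅ → ∫ x, g x * fourierS ψ x = 0

/-- Smooth cutoff equal to `1` near `e`, supported in the ball of radius `1/4` around `e`. -/
def symbolCutoff {d : ℕ} (e : RD d) : ContDiffBump e where
  rIn := 1/8
  rOut := 1/4
  rIn_pos := by norm_num
  rIn_lt_rOut := by norm_num

/-- The plane wave `x ↦ e^{-2πi⟨x,e⟩}`. -/
def planeWave {d : ℕ} (e x : RD d) : ℂ :=
  Complex.exp (-(2 * Real.pi * Complex.I * ((⟪x, e⟫ : ℝ) : ℂ)))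

/-- The `j`-th dyadic piece of Ching's symbol. -/
def chingPiece {d : ℕ} (m : ℝ) (e : RD d) (j : ℕ) (x ξ : RD d) : ℂ :=
  (((2:ℝ)^j)^m * symbolCutoff e (((2:ℝ)^j)⁻¹ • ξ)) • planeWave e ((2:ℝ)^j • x)

/-- Ching's symbol, whose dyadic pieces shift the frequencies near `2^j e` to the origin. -/
def chingSymbol {d : ℕ} (m : ℝ) (e : RD d) (x ξ : RD d) : ℂ :=
  ∑' j : ℕ, chingPiece m e j x ξ

lemma symbolCutoff_eq_zero {d : ℕ} {e : RD d} (he : ‖e‖ = 1) {u : RD d}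
    (hu : ‖u‖ ≤ 3/4 ∨ 5/4 ≤ ‖u‖) : symbolCutoff e u = 0 := by
  apply ContDiffBump.zero_of_le_dist
  change 1/4 ≤ dist u e
  rw [dist_eq_norm]
  have h1 := norm_sub_norm_le u e
  have h2 := norm_sub_norm_le e u
  rw [norm_sub_rev] at h2
  rcases hu with h | h <;> linarith

lemma chingPiece_eq_zero {d : ℕ} {m : ℝ} {e : RD d} (he : ‖e‖ = 1) {j : ℕ} {x ξ : RD d}
    (h : ‖ξ‖ ≤ 3/4 * 2^j ∨ 5/4 * 2^j ≤ ‖ξ‖) : chingPiece m e j x ξ = 0 := by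
  have h2 : (0:ℝ) < 2^j := by positivity
  have : symbolCutoff e (((2:ℝ)^j)⁻¹ • ξ) = 0 := by
    apply symbolCutoff_eq_zero he
    rw [norm_smul, norm_inv, norm_pow, Real.norm_ofNat, inv_mul_le_iff₀ h2, le_inv_mul_iff₀ h2]
    rcases h with h | h
    · left; linarith
    · right; linarith
  rw [chingPiece, this, mul_zero, zero_smul]

/-- Where only the `n`-th cutoff can be nonzero, the symbol reduces to its `n`-th piece. -/
lemma chingSymbol_eq_piece {d : ℕ} {m : ℝ} {e : RD d} (he : ‖e‖ = 1) {n : ℕ} {x ξ : RD d}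
    (hlow : n = 0 ∨ 5/8 * 2^n ≤ ‖ξ‖) (hhigh : ‖ξ‖ ≤ 3/2 * 2^n) :
    chingSymbol m e x ξ = chingPiece m e n x ξ := by
  refine tsum_eq_single n fun j hj => chingPiece_eq_zero he ?_
  rcases lt_or_gt_of_ne hj with h | h
  · right
    rcases hlow with h0 | h0
    · omega
    · have : (2:ℝ)^(j+1) ≤ 2^n := pow_le_pow_right₀ (by norm_num) h
      rw [pow_succ] at this
      linarith
  · left
    have : (2:ℝ)^(n+1) ≤ 2^j := pow_le_pow_right₀ (by norm_num) h
    rw [pow_succ] at this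
    linarith

/-- Near each frequency the symbol coincides with a single piece of comparable frequency. -/
lemma exists_chingSymbol_eventually_eq {d : ℕ} (m : ℝ) {e : RD d} (he : ‖e‖ = 1) (ξ : RD d) :
    ∃ n : ℕ, (2:ℝ)^n ≤ 4 * (1 + ‖ξ‖) ∧ 1 + ‖ξ‖ ≤ 4 * 2^n ∧
      ∀ᶠ ξ' in nhds ξ, ∀ x, chingSymbol m e x ξ' = chingPiece m e n x ξ' := by
  have hex : ∃ n : ℕ, ‖ξ‖ < 7/5 * 2^n := by
    obtain ⟨n, hn⟩ := pow_unbounded_of_one_lt ‖ξ‖ (one_lt_two : (1:ℝ) < 2)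
    exact ⟨n, by have : (0:ℝ) < 2^n := by positivity
                 linarith⟩
  classical
  set n := Nat.find hex with hn
  have hup : ‖ξ‖ < 7/5 * 2^n := Nat.find_spec hex
  have hlow : n = 0 ∨ 7/10 * 2^n ≤ ‖ξ‖ := by
    rcases Nat.eq_zero_or_pos n with h | h
    · exact Or.inl h
    · right
      have := Nat.find_min hex (m := n - 1) (by omega)
      have h2 : (2:ℝ)^n = 2^(n-1) * 2 := by rw [← pow_succ]; congr 1; omega
      rw [h2]
      push Not at this
      linarith
  have hpos : (1:ℝ) ≤ 2^n := one_le_pow₀ (by norm_num)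
  have hξ := norm_nonneg ξ
  refine ⟨n, ?_, by linarith, ?_⟩
  · rcases hlow with h | h
    · rw [h]; norm_num; linarith
    · linarith
  · have h1 : ∀ᶠ ξ' in nhds ξ, ‖ξ'‖ < 3/2 * 2^n :=
      continuous_norm.continuousAt.eventually_lt continuousAt_const (by linarith)
    have h2 : ∀ᶠ ξ' in nhds ξ, n = 0 ∨ 5/8 * 2^n ≤ ‖ξ'‖ := by
      rcases hlow with h | h
      · exact Eventually.of_forall fun _ => Or.inl h
      · have : ∀ᶠ ξ' in nhds ξ, 5/8 * 2^n < ‖ξ'‖ :=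
          continuousAt_const.eventually_lt continuous_norm.continuousAt (by linarith)
        filter_upwards [this] with ξ' h' using Or.inr h'.le
    filter_upwards [h1, h2] with ξ' h1 h2 x using chingSymbol_eq_piece he h2 h1.le

lemma contDiff_planeWave {d : ℕ} (e : RD d) : ContDiff ℝ ∞ (planeWave e) := by
  unfold planeWave
  apply ContDiff.cexp
  apply ContDiff.neg
  apply ContDiff.mul contDiff_const
  exact Complex.ofRealCLM.contDiff.comp (contDiff_id.inner ℝ contDiff_const)

lemma norm_planeWave {d : ℕ} (e x : RD d) : ‖planeWave e x‖ = 1 := by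
  rw [planeWave, Complex.norm_exp]
  simp

lemma planeWave_add {d : ℕ} (e x y : RD d) :
    planeWave e (x + y) = planeWave e x * planeWave e y := by
  rw [planeWave, planeWave, planeWave, ← Complex.exp_add, inner_add_left]
  congr 1
  push_cast
  ring

lemma norm_iteratedFDeriv_planeWave {d : ℕ} (e : RD d) (β : ℕ) (x : RD d) :
    ‖iteratedFDeriv ℝ β (planeWave e) x‖ = ‖iteratedFDeriv ℝ β (planeWave e) 0‖ := by
  have h1 : (fun z => planeWave e (z + x)) = planeWave e x • planeWave e := by
    ext z
    rw [planeWave_add, mul_comm]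
    rfl
  have h2 := iteratedFDeriv_comp_add_right (𝕜 := ℝ) (f := planeWave e) β x 0
  rw [h1, zero_add, iteratedFDeriv_const_smul_apply
    (((contDiff_planeWave e).of_le (mod_cast le_top)).contDiffAt)] at h2
  rw [← h2, norm_smul, norm_planeWave, one_mul]

lemma exists_norm_iteratedFDeriv_symbolCutoff_le {d : ℕ} (e : RD d) (α : ℕ) :
    ∃ B : ℝ, ∀ u, ‖iteratedFDeriv ℝ α (symbolCutoff e) u‖ ≤ B := by
  have hc : Continuous (iteratedFDeriv ℝ α (symbolCutoff e)) :=
    (symbolCutoff e).contDiff.continuous_iteratedFDeriv'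
  exact hc.bounded_above_of_compact_support ((symbolCutoff e).hasCompactSupport.iteratedFDeriv α)

lemma rpow_le_of_comparable {A t y : ℝ} (hA : 1 ≤ A) (ht : 0 < t) (hy : 0 < y)
    (hty : t ≤ A * y) (hyt : y ≤ A * t) (p : ℝ) : t^p ≤ A^|p| * y^p := by
  have hA0 : 0 < A := by linarith
  rcases le_total 0 p with hp | hp
  · rw [abs_of_nonneg hp, ← Real.mul_rpow hA0.le hy.le]
    exact Real.rpow_le_rpow ht.le hty hp
  · rw [abs_of_nonpos hp, Real.rpow_neg hA0.le, ← Real.inv_rpow hA0.le,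
      ← Real.mul_rpow (by positivity) hy.le]
    refine Real.rpow_le_rpow_of_nonpos (by positivity) ?_ hp
    rwa [inv_mul_le_iff₀ hA0]

lemma contDiff_chingPiece {d : ℕ} (m : ℝ) (e : RD d) (j : ℕ) :
    ContDiff ℝ ∞ (fun p : RD d × RD d => chingPiece m e j p.1 p.2) := by
  unfold chingPiece
  apply ContDiff.fun_smul
  · exact contDiff_const.mul ((symbolCutoff e).contDiff.comp (contDiff_snd.const_smul _))
  · exact (contDiff_planeWave e).comp (contDiff_fst.const_smul _)

lemma norm_iteratedFDeriv_chingPiece_le {d : ℕ} (m : ℝ) (e : RD d) {α β : ℕ} {B : ℝ}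
    (hB : ∀ u, ‖iteratedFDeriv ℝ α (symbolCutoff e) u‖ ≤ B) (j : ℕ) (x ξ : RD d) :
    ‖iteratedFDeriv ℝ α (fun ξ' => iteratedFDeriv ℝ β (fun x' => chingPiece m e j x' ξ') x) ξ‖
      ≤ B * ‖iteratedFDeriv ℝ β (planeWave e) 0‖ * ((2:ℝ)^j) ^ (m - (α : ℝ) + (β : ℝ)) := by
  set T : ℝ := 2^j with hT
  have hT0 : 0 < T := by positivity
  set M := iteratedFDeriv ℝ β (fun x' => planeWave e (T • x')) x with hM
  have hMn : ‖M‖ = T^β * ‖iteratedFDeriv ℝ β (planeWave e) 0‖ := by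
    rw [hM, iteratedFDeriv_comp_const_smul T ((contDiff_planeWave e).of_le (mod_cast le_top)),
      norm_smul, norm_iteratedFDeriv_planeWave, norm_pow, Real.norm_of_nonneg hT0.le]
  have hψ : ContDiff ℝ α (symbolCutoff e) := (symbolCutoff e).contDiff
  have hψ' : ContDiff ℝ α (fun ξ' : RD d => symbolCutoff e (T⁻¹ • ξ')) :=
    hψ.comp (contDiff_const_smul _)
  have hfun : (fun ξ' => iteratedFDeriv ℝ β (fun x' => chingPiece m e j x' ξ') x)
      = ((ContinuousLinearMap.id ℝ ℝ).smulRight (T^m • M)) ∘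
        (fun ξ' : RD d => symbolCutoff e (T⁻¹ • ξ')) := by
    ext1 ξ'
    simp only [Function.comp_apply, ContinuousLinearMap.smulRight_apply,
      ContinuousLinearMap.id_apply, smul_smul]
    rw [mul_comm, hM, ← iteratedFDeriv_const_smul_apply]
    · rfl
    · exact (((contDiff_planeWave e).of_le (mod_cast le_top)).comp
        (contDiff_const_smul T)).contDiffAt
  rw [hfun]
  refine (ContinuousLinearMap.norm_iteratedFDeriv_comp_left _ hψ'.contDiffAt le_rfl).trans ?_
  rw [iteratedFDeriv_comp_const_smul _ hψ, ContinuousLinearMap.norm_smulRight_apply, norm_smul,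
    norm_smul, hMn, Real.norm_of_nonneg (by positivity : 0 ≤ T^m),
    Real.norm_of_nonneg (by positivity : 0 ≤ (T⁻¹)^α)]
  have hpow : T ^ (m - (α : ℝ) + (β : ℝ)) = T^m * (T⁻¹)^α * T^β := by
    rw [Real.rpow_add hT0, Real.rpow_sub hT0, Real.rpow_natCast, Real.rpow_natCast, inv_pow,
      div_eq_mul_inv]
  rw [hpow]
  have hid : ‖ContinuousLinearMap.id ℝ ℝ‖ = 1 := ContinuousLinearMap.norm_id
  rw [hid, one_mul]
  calc _ ≤ T ^ m * (T ^ β * ‖iteratedFDeriv ℝ β (planeWave e) 0‖) * ((T⁻¹) ^ α * B) := by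
        gcongr
        exact hB _
    _ = _ := by ring

lemma isSymbolS11_chingSymbol {d : ℕ} (m : ℝ) {e : RD d} (he : ‖e‖ = 1) :
    IsSymbolS11 d m (chingSymbol m e) := by
  refine ⟨contDiff_iff_contDiffAt.2 fun p => ?_, fun α β => ?_⟩
  · obtain ⟨n, -, -, hn⟩ := exists_chingSymbol_eventually_eq m he p.2
    refine (contDiff_chingPiece m e n).contDiffAt.congr_of_eventuallyEq ?_
    filter_upwards [continuous_snd.continuousAt.eventually hn] with p' hp' using hp' p'.1
  · obtain ⟨B, hB⟩ := exists_norm_iteratedFDeriv_symbolCutoff_le e α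
    have hB0 : 0 ≤ B := (norm_nonneg _).trans (hB 0)
    refine ⟨B * ‖iteratedFDeriv ℝ β (planeWave e) 0‖ * (4:ℝ)^|m - (α : ℝ) + (β : ℝ)|,
      fun x ξ => ?_⟩
    obtain ⟨n, h1, h2, hn⟩ := exists_chingSymbol_eventually_eq m he ξ
    have heq : (fun ξ' => iteratedFDeriv ℝ β (fun x' => chingSymbol m e x' ξ') x) =ᶠ[nhds ξ]
        (fun ξ' => iteratedFDeriv ℝ β (fun x' => chingPiece m e n x' ξ') x) := by
      filter_upwards [hn] with ξ' h
      simp only [h]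
    rw [(heq.iteratedFDeriv ℝ α).self_of_nhds]
    refine (norm_iteratedFDeriv_chingPiece_le m e hB n x ξ).trans ?_
    rw [mul_assoc _ ((4:ℝ)^_)]
    gcongr
    exact rpow_le_of_comparable (by norm_num) (by positivity) (by positivity) h1 h2 _

lemma fourierS_eq {d : ℕ} (f : 𝓢(RD d, ℂ)) (ξ : RD d) :
    fourierS f ξ = ∫ y, Real.fourierChar (-⟪y, ξ⟫) • f y := rfl

lemma integrable_LPkernel {d : ℕ} (D : LPData d) (k : ℕ) : Integrable (LPkernel D k) := by
  cases k with
  | zero => exact D.Φ.integrable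
  | succ k =>
    exact ((integrable_comp_smul_iff volume D.φ (by positivity)).2 D.φ.integrable).const_mul _

lemma integral_fourierChar_LPkernel {d : ℕ} (D : LPData d) (k : ℕ) (ξ : RD d) :
    ∫ y, Real.fourierChar (-⟪y, ξ⟫) • LPkernel D k y = LPhat D k ξ := by
  cases k with
  | zero => rfl
  | succ k =>
    rw [LPhat, fourierS_eq]
    set T : ℝ := 2^(k+1) with hT
    have hT0 : 0 < T := by positivity
    have h := Measure.integral_comp_smul_of_nonneg (volume : Measure (RD d))
      (fun y => Real.fourierChar (-⟪y, T⁻¹ • ξ⟫) • D.φ y) T (hR := hT0.le)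
    have h' : ∫ y, Real.fourierChar (-⟪y, T⁻¹ • ξ⟫) • D.φ y
        = (T^d) • ∫ y, Real.fourierChar (-⟪T • y, T⁻¹ • ξ⟫) • D.φ (T • y) := by
      rw [h, finrank_euclideanSpace_fin, smul_smul, mul_inv_cancel₀ (by positivity), one_smul]
    rw [h', ← integral_smul]
    congr 1 with y
    rw [inner_smul_left, inner_smul_right, ← mul_assoc]
    simp only [conj_trivial, mul_inv_cancel₀ hT0.ne', one_mul, LPkernel, Circle.smul_def,
      smul_eq_mul, Complex.real_smul]
    rw [pow_mul]
    ring

lemma fourierInv_apply {d : ℕ} (F : 𝓢(RD d, ℂ)) (x : RD d) :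
    (FourierTransformInv.fourierInv F : 𝓢(RD d, ℂ)) x
      = ∫ ξ, F ξ * Complex.exp (2 * Real.pi * Complex.I * ((⟪x, ξ⟫ : ℝ) : ℂ)) := by
  rw [SchwartzMap.fourierInv_coe, Real.fourierInv_eq']
  congr 1 with ξ
  rw [smul_eq_mul, mul_comm, real_inner_comm]
  congr 2
  push_cast
  ring

lemma norm_exp_two_pi_I {d : ℕ} (x ξ : RD d) :
    ‖Complex.exp (2 * Real.pi * Complex.I * ((⟪x, ξ⟫ : ℝ) : ℂ))‖ = 1 := by
  rw [Complex.norm_exp]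
  simp

lemma LP_fourierInv {d : ℕ} (D : LPData d) (k : ℕ) (F : 𝓢(RD d, ℂ)) (x : RD d) :
    LP D k (FourierTransformInv.fourierInv F : 𝓢(RD d, ℂ)) x = ∫ ξ, LPhat D k ξ *
      (F ξ * Complex.exp (2 * Real.pi * Complex.I * ((⟪x, ξ⟫ : ℝ) : ℂ))) := by
  set h : RD d → ℂ := fun ξ => F ξ * Complex.exp (2 * Real.pi * Complex.I * ((⟪x, ξ⟫ : ℝ) : ℂ))
    with hh
  have hint : Integrable h := F.integrable.mul_bdd (c := 1) (by fun_prop)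
    (Eventually.of_forall fun ξ => (norm_exp_two_pi_I x ξ).le)
  have key := VectorFourier.integral_fourierIntegral_smul_eq_flip (μ := volume) (ν := volume)
    (L := innerₗ (RD d)) Real.continuous_fourierChar
    (by simpa using (continuous_inner : Continuous fun p : RD d × RD d => inner ℝ p.1 p.2))
    (integrable_LPkernel D k) hint
  simp only [smul_eq_mul, VectorFourier.fourierIntegral, innerₗ_apply_apply,
    LinearMap.flip_apply, integral_fourierChar_LPkernel] at key
  rw [key, LP]
  congr 1 with y
  congr 1
  rw [fourierInv_apply]
  congr 1 with ξ
  rw [hh, Circle.smul_def, Real.fourierChar_apply, smul_eq_mul, mul_left_comm, ← Complex.exp_add,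
    inner_sub_left]
  congr 2
  push_cast
  ring

lemma exists_norm_LPhat_le {d : ℕ} (D : LPData d) : ∃ A : ℝ, 0 ≤ A ∧ ∀ k ξ, ‖LPhat D k ξ‖ ≤ A := by
  refine ⟨max (SchwartzMap.seminorm ℝ 0 0 (fourierS D.Φ))
      (SchwartzMap.seminorm ℝ 0 0 (fourierS D.φ)),
    le_max_of_le_left (apply_nonneg _ _), fun k ξ => ?_⟩
  cases k with
  | zero => exact le_max_of_le_left (SchwartzMap.norm_le_seminorm ℝ _ _)
  | succ k => exact le_max_of_le_right (SchwartzMap.norm_le_seminorm ℝ _ _)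

lemma continuous_LPhat {d : ℕ} (D : LPData d) (k : ℕ) : Continuous (LPhat D k) := by
  cases k with
  | zero => exact (fourierS D.Φ).continuous
  | succ k => exact (fourierS D.φ).continuous.comp (continuous_const_smul _)

lemma LPhat_zero_eq_one {d : ℕ} (D : LPData d) {ξ : RD d} (hξ : ‖ξ‖ < 1) : LPhat D 0 ξ = 1 := by
  rw [LPhat, D.Φ_def]
  have : ∀ k : ℕ, fourierS D.φ (((2:ℝ)^(k+1))⁻¹ • ξ) = 0 := by
    intro k
    by_contra h
    have h1 := (D.supp_φ _ h).1
    rw [norm_smul, norm_inv, norm_pow, Real.norm_ofNat, le_inv_mul_iff₀ (by positivity), pow_succ]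
      at h1
    have : (1:ℝ) ≤ 2^k := one_le_pow₀ (by norm_num)
    linarith
  simp [this]

lemma LPhat_zero_eq_zero {d : ℕ} (D : LPData d) {ξ : RD d} (hξ : 2 < ‖ξ‖) :
    LPhat D 0 ξ = 0 := by
  rw [LPhat, D.Φ_def]
  have hξ0 : ξ ≠ 0 := by
    rintro rfl
    norm_num at hξ
  have hinj : Function.Injective (fun k : ℕ => (k:ℤ) + 1) := fun a b h => by simpa using h
  have h := D.sum_φ ξ hξ0
  rw [← hinj.hasSum_iff] at h
  · have h' : HasSum (fun k : ℕ => fourierS D.φ (((2:ℝ)^(k+1))⁻¹ • ξ)) 1 := by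
      convert! h using 3 with k
    rw [h'.tsum_eq, sub_self]
  · intro k hk
    by_contra h
    have h1 := (D.supp_φ _ h).2
    have hk0 : k ≤ 0 := by
      by_contra hk0
      exact hk ⟨(k-1).toNat, by simp; omega⟩
    have h2 : (1:ℝ) ≤ 2^(-k) := one_le_zpow₀ (by norm_num) (by omega)
    rw [norm_smul, Real.norm_of_nonneg (by positivity)] at h1
    nlinarith

/-- A bump function in frequency space of small support around `c`. -/
def freqBump {d : ℕ} (c : RD d) : ContDiffBump c where
  rIn := 1/16
  rOut := 1/8
  rIn_pos := by norm_num
  rIn_lt_rOut := by norm_num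

/-- `freqBump c` as a complex-valued Schwartz function. -/
def freqBumpS {d : ℕ} (c : RD d) : 𝓢(RD d, ℂ) :=
  ((freqBump c).hasCompactSupport.comp_left Complex.ofReal_zero).toSchwartzMap
    (Complex.ofRealCLM.contDiff.comp (freqBump c).contDiff)

lemma freqBumpS_apply {d : ℕ} (c ξ : RD d) : freqBumpS c ξ = ((freqBump c ξ : ℝ) : ℂ) := rfl

lemma freqBump_add {d : ℕ} (c ξ : RD d) : freqBump c (ξ + c) = freqBump 0 ξ := by
  rw [ContDiffBump.apply, ContDiffBump.apply]
  simp [freqBump]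

lemma norm_sub_lt_of_freqBumpS_ne_zero {d : ℕ} {c ξ : RD d} (h : freqBumpS c ξ ≠ 0) :
    ‖ξ - c‖ < 1/8 := by
  by_contra h'
  push Not at h'
  apply h
  rw [freqBumpS_apply, ContDiffBump.zero_of_le_dist, Complex.ofReal_zero]
  rwa [dist_eq_norm]

lemma norm_bounds_of_freqBumpS_ne_zero {d : ℕ} {e : RD d} (he : ‖e‖ = 1) {j : ℕ} {ξ : RD d}
    (h : freqBumpS ((2:ℝ)^j • e) ξ ≠ 0) : 2^j - 1/8 < ‖ξ‖ ∧ ‖ξ‖ < 2^j + 1/8 := by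
  have h0 := norm_sub_lt_of_freqBumpS_ne_zero h
  have hc : ‖(2:ℝ)^j • e‖ = 2^j := by
    rw [norm_smul, he, mul_one, Real.norm_of_nonneg (by positivity)]
  have h1 := norm_sub_norm_le ξ ((2:ℝ)^j • e)
  have h2 := norm_sub_norm_le ((2:ℝ)^j • e) ξ
  rw [norm_sub_rev] at h2
  constructor <;> linarith

/-- The Littlewood–Paley pieces only see frequency bumps of comparable frequency. -/
lemma LPhat_mul_freqBumpS_eq_zero {d : ℕ} (D : LPData d) {e : RD d} (he : ‖e‖ = 1) {j k : ℕ}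
    (hj : 2 ≤ j) (hjk : ¬ (j ≤ k + 1 ∧ k ≤ j + 1)) (ξ : RD d) :
    LPhat D k ξ * freqBumpS ((2:ℝ)^j • e) ξ = 0 := by
  by_contra hne
  obtain ⟨h1, h2⟩ := mul_ne_zero_iff.1 hne
  obtain ⟨h3, h4⟩ := norm_bounds_of_freqBumpS_ne_zero he h2
  have hj4 : (2:ℝ)^2 ≤ 2^j := pow_le_pow_right₀ (by norm_num) hj
  cases k with
  | zero => exact h1 (LPhat_zero_eq_zero D (by linarith))
  | succ k =>
    obtain ⟨h5, h6⟩ := D.supp_φ _ h1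
    have hk0 : (0:ℝ) < 2^(k+1) := by positivity
    rw [norm_smul, norm_inv, norm_pow, Real.norm_ofNat, le_inv_mul_iff₀ hk0] at h5
    rw [norm_smul, norm_inv, norm_pow, Real.norm_ofNat, inv_mul_le_iff₀ hk0] at h6
    apply hjk
    constructor
    · by_contra h
      have : (2:ℝ)^(k+3) ≤ 2^j := pow_le_pow_right₀ (by norm_num) (by omega)
      have h7 : (2:ℝ)^(k+3) = 2^(k+1) * 4 := by ring
      linarith
    · by_contra h
      have : (2:ℝ)^(j+2) ≤ 2^(k+1) := pow_le_pow_right₀ (by norm_num) (by omega)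
      have h7 : (2:ℝ)^(j+2) = 2^j * 4 := by ring
      linarith

lemma integral_freqBump {d : ℕ} (c : RD d) : ∫ ξ, freqBump c ξ = ∫ ξ, freqBump (0 : RD d) ξ := by
  rw [← integral_add_right_eq_self _ c]
  simp only [freqBump_add]

lemma norm_LP_fourierInv_freqBumpS_le {d : ℕ} (D : LPData d) {A : ℝ}
    (hA : ∀ k ξ, ‖LPhat D k ξ‖ ≤ A) (k : ℕ) (c x : RD d) :
    ‖LP D k (FourierTransformInv.fourierInv (freqBumpS c) : 𝓢(RD d, ℂ)) x‖
      ≤ A * ∫ ξ, freqBump (0 : RD d) ξ := by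
  rw [LP_fourierInv, ← integral_freqBump c, ← integral_const_mul]
  refine norm_integral_le_of_norm_le ((freqBump c).continuous.integrable_of_hasCompactSupport
    (freqBump c).hasCompactSupport |>.const_mul A) (Eventually.of_forall fun ξ => ?_)
  rw [norm_mul, norm_mul, norm_exp_two_pi_I, mul_one, freqBumpS_apply, Complex.norm_real,
    Real.norm_of_nonneg (freqBump c).nonneg]
  gcongr
  · exact (freqBump c).nonneg
  · exact hA k ξ

lemma LP_fourierInv_freqBumpS_eq_zero {d : ℕ} (D : LPData d) {e : RD d} (he : ‖e‖ = 1) {j k : ℕ}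
    (hj : 2 ≤ j) (hjk : ¬ (j ≤ k + 1 ∧ k ≤ j + 1)) (x : RD d) :
    LP D k (FourierTransformInv.fourierInv (freqBumpS ((2:ℝ)^j • e)) : 𝓢(RD d, ℂ)) x = 0 := by
  rw [LP_fourierInv]
  simp [← mul_assoc, LPhat_mul_freqBumpS_eq_zero D he hj hjk]

/-- The Fourier transform of the test function `∑_{j=2}^{N+1} 2^{-jσ} e^{2πi 2^j⟨x,e⟩} η(x)`. -/
def testHat {d : ℕ} (σ : ℝ) (e : RD d) (N : ℕ) : 𝓢(RD d, ℂ) :=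
  ∑ j ∈ Finset.Ico 2 (N+2), ((((2:ℝ)^j)^(-σ) : ℝ) : ℂ) • freqBumpS ((2:ℝ)^j • e)

lemma testHat_apply {d : ℕ} (σ : ℝ) (e : RD d) (N : ℕ) (ξ : RD d) :
    testHat σ e N ξ = ∑ j ∈ Finset.Ico 2 (N+2),
      ((((2:ℝ)^j)^(-σ) : ℝ) : ℂ) * freqBumpS ((2:ℝ)^j • e) ξ := by
  simp [testHat]

lemma integrable_LPhat_mul {d : ℕ} (D : LPData d) (k : ℕ) (F : 𝓢(RD d, ℂ)) (x : RD d) :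
    Integrable fun ξ => LPhat D k ξ *
      (F ξ * Complex.exp (2 * Real.pi * Complex.I * ((⟪x, ξ⟫ : ℝ) : ℂ))) := by
  obtain ⟨A, -, hA⟩ := exists_norm_LPhat_le D
  refine Integrable.bdd_mul (c := A) ?_ (continuous_LPhat D k).aestronglyMeasurable
    (Eventually.of_forall (hA k))
  exact F.integrable.mul_bdd (c := 1) (by fun_prop)
    (Eventually.of_forall fun ξ => (norm_exp_two_pi_I x ξ).le)

lemma LP_testFunction {d : ℕ} (D : LPData d) (k : ℕ) (σ : ℝ) (e : RD d) (N : ℕ) (x : RD d) :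
    LP D k (FourierTransformInv.fourierInv (testHat σ e N) : 𝓢(RD d, ℂ)) x =
      ∑ j ∈ Finset.Ico 2 (N+2), ((((2:ℝ)^j)^(-σ) : ℝ) : ℂ) *
        LP D k (FourierTransformInv.fourierInv (freqBumpS ((2:ℝ)^j • e)) : 𝓢(RD d, ℂ)) x := by
  simp only [LP_fourierInv, ← integral_const_mul]
  rw [← integral_finsetSum _ fun j _ => (integrable_LPhat_mul D k _ x).const_mul _]
  congr 1 with ξ
  rw [testHat_apply, Finset.sum_mul, Finset.mul_sum]
  exact Finset.sum_congr rfl fun j _ => by ring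

lemma LP_testFunction_eq_zero {d : ℕ} (D : LPData d) {e : RD d} (he : ‖e‖ = 1) (σ : ℝ) {N k : ℕ}
    (hk : k = 0 ∨ N + 3 ≤ k) (x : RD d) :
    LP D k (FourierTransformInv.fourierInv (testHat σ e N) : 𝓢(RD d, ℂ)) x = 0 := by
  rw [LP_testFunction]
  refine Finset.sum_eq_zero fun j hj => ?_
  rw [Finset.mem_Ico] at hj
  rw [LP_fourierInv_freqBumpS_eq_zero D he hj.1 (by omega), mul_zero]

lemma norm_LP_testFunction_le {d : ℕ} (D : LPData d) {A : ℝ} (hA0 : 0 ≤ A)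
    (hA : ∀ k ξ, ‖LPhat D k ξ‖ ≤ A) {e : RD d} (he : ‖e‖ = 1) (σ : ℝ) (N k : ℕ) (x : RD d) :
    (2:ℝ)^(σ*k) * ‖LP D k (FourierTransformInv.fourierInv (testHat σ e N) : 𝓢(RD d, ℂ)) x‖
      ≤ 3 * (2^|σ| * (A * ∫ ξ, freqBump (0 : RD d) ξ)) := by
  set K : ℝ := 2^|σ| * (A * ∫ ξ, freqBump (0 : RD d) ξ) with hK
  have hI : 0 ≤ ∫ ξ, freqBump (0 : RD d) ξ := integral_nonneg fun ξ => (freqBump 0).nonneg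
  have hK0 : 0 ≤ K := by positivity
  rw [LP_testFunction]
  have hterm : ∀ j ∈ Finset.Ico 2 (N+2), (2:ℝ)^(σ*k) * ‖((((2:ℝ)^j)^(-σ) : ℝ) : ℂ) *
        LP D k (FourierTransformInv.fourierInv (freqBumpS ((2:ℝ)^j • e)) : 𝓢(RD d, ℂ)) x‖
      ≤ if j ∈ Finset.Icc (k-1) (k+1) then K else 0 := by
    intro j hj
    rw [Finset.mem_Ico] at hj
    by_cases hjk : j ≤ k + 1 ∧ k ≤ j + 1
    · rw [if_pos (by rw [Finset.mem_Icc]; omega), norm_mul, Complex.norm_real,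
        Real.norm_of_nonneg (by positivity), ← mul_assoc, hK]
      gcongr
      · rw [← Real.rpow_natCast, ← Real.rpow_mul (by norm_num), ← Real.rpow_add (by norm_num)]
        refine Real.rpow_le_rpow_of_exponent_le (by norm_num) ?_
        have h1 : (j:ℝ) ≤ k + 1 := by exact_mod_cast hjk.1
        have h2 : (k:ℝ) ≤ j + 1 := by exact_mod_cast hjk.2
        have h3 : σ * k + j * (-σ) = σ * (k - j) := by ring
        rw [h3]
        refine (le_abs_self _).trans ?_
        rw [abs_mul]
        exact mul_le_of_le_one_right (abs_nonneg _) (abs_le.2 ⟨by linarith, by linarith⟩)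
      · exact norm_LP_fourierInv_freqBumpS_le D hA k _ x
    · rw [LP_fourierInv_freqBumpS_eq_zero D he hj.1 hjk, mul_zero, norm_zero, mul_zero]
      split_ifs <;> simp [hK0]
  calc _ ≤ (2:ℝ)^(σ*k) * ∑ j ∈ Finset.Ico 2 (N+2), ‖((((2:ℝ)^j)^(-σ) : ℝ) : ℂ) *
        LP D k (FourierTransformInv.fourierInv (freqBumpS ((2:ℝ)^j • e)) : 𝓢(RD d, ℂ)) x‖ := by
        gcongr
        exact norm_sum_le _ _
    _ ≤ ∑ j ∈ Finset.Ico 2 (N+2), if j ∈ Finset.Icc (k-1) (k+1) then K else 0 := by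
        rw [Finset.mul_sum]
        exact Finset.sum_le_sum hterm
    _ ≤ ∑ j ∈ Finset.Icc (k-1) (k+1), K := by
        rw [← Finset.sum_filter]
        refine Finset.sum_le_sum_of_subset_of_nonneg (fun j hj => (Finset.mem_filter.1 hj).2)
          fun _ _ _ => hK0
    _ ≤ 3 * K := by
        rw [Finset.sum_const, nsmul_eq_mul, Nat.card_Icc]
        gcongr
        exact_mod_cast (by omega : k + 1 + 1 - (k - 1) ≤ 3)

lemma chingSymbol_mul_freqBumpS {d : ℕ} (m : ℝ) {e : RD d} (he : ‖e‖ = 1) {j : ℕ} (hj : 2 ≤ j)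
    (x ξ : RD d) :
    chingSymbol m e x ξ * freqBumpS ((2:ℝ)^j • e) ξ =
      ((((2:ℝ)^j)^m : ℝ) : ℂ) * planeWave e ((2:ℝ)^j • x) * freqBumpS ((2:ℝ)^j • e) ξ := by
  by_cases h : freqBumpS ((2:ℝ)^j • e) ξ = 0
  · rw [h, mul_zero, mul_zero]
  obtain ⟨h1, h2⟩ := norm_bounds_of_freqBumpS_ne_zero he h
  have hj4 : (2:ℝ)^2 ≤ 2^j := pow_le_pow_right₀ (by norm_num) hj
  have hj0 : (0:ℝ) < 2^j := by positivity
  rw [chingSymbol_eq_piece he (n := j) (Or.inr (by linarith)) (by linarith), chingPiece]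
  have hcut : symbolCutoff e (((2:ℝ)^j)⁻¹ • ξ) = 1 := by
    apply ContDiffBump.one_of_mem_closedBall
    rw [mem_closedBall_iff_norm]
    have h3 : ((2:ℝ)^j)⁻¹ • ξ - e = ((2:ℝ)^j)⁻¹ • (ξ - (2:ℝ)^j • e) := by
      rw [smul_sub, smul_smul, inv_mul_cancel₀ hj0.ne', one_smul]
    rw [h3, norm_smul, norm_inv, Real.norm_of_nonneg hj0.le, inv_mul_le_iff₀ hj0]
    have h4 := norm_sub_lt_of_freqBumpS_ne_zero h
    change _ ≤ 2^j * (1/8 : ℝ)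
    linarith
  rw [hcut, mul_one, Complex.real_smul]

lemma planeWave_mul_fourierInv_freqBumpS {d : ℕ} (e x : RD d) (t : ℝ) :
    planeWave e (t • x) * (FourierTransformInv.fourierInv (freqBumpS (t • e)) : 𝓢(RD d, ℂ)) x =
      (FourierTransformInv.fourierInv (freqBumpS 0) : 𝓢(RD d, ℂ)) x := by
  rw [fourierInv_apply, fourierInv_apply, ← integral_add_right_eq_self _ (t • e),
    ← integral_const_mul]
  congr 1 with ξ
  rw [freqBumpS_apply, freqBumpS_apply, freqBump_add, planeWave, mul_left_comm, ← Complex.exp_add,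
    inner_add_right, inner_smul_left, inner_smul_right]
  congr 2
  simp only [conj_trivial]
  push_cast
  ring

lemma pdo_chingSymbol_testFunction {d : ℕ} (m s : ℝ) {e : RD d} (he : ‖e‖ = 1) (N : ℕ)
    (x : RD d) :
    pdo (chingSymbol m e) (FourierTransformInv.fourierInv (testHat (s+m) e N)) x =
      ((∑ j ∈ Finset.Ico 2 (N+2), ((2:ℝ)^j)^(-s) : ℝ) : ℂ) *
        (FourierTransformInv.fourierInv (freqBumpS 0) : 𝓢(RD d, ℂ)) x := by
  have hF : fourierS (FourierTransformInv.fourierInv (testHat (s+m) e N)) = testHat (s+m) e N := by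
    rw [fourierS, SchwartzMap.fourierTransformCLM_apply, FourierTransform.fourier_fourierInv_eq]
  have hint : ∀ j : ℕ, Integrable fun ξ => freqBumpS ((2:ℝ)^j • e) ξ *
      Complex.exp (2 * Real.pi * Complex.I * ((⟪x, ξ⟫ : ℝ) : ℂ)) := fun j =>
    (freqBumpS ((2:ℝ)^j • e)).integrable.mul_bdd (c := 1) (by fun_prop)
      (Eventually.of_forall fun ξ => (norm_exp_two_pi_I x ξ).le)
  calc pdo (chingSymbol m e) (FourierTransformInv.fourierInv (testHat (s+m) e N)) x
      = ∫ ξ, ∑ j ∈ Finset.Ico 2 (N+2), ((((2:ℝ)^j)^(-s) : ℝ) : ℂ) *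
          planeWave e ((2:ℝ)^j • x) * (freqBumpS ((2:ℝ)^j • e) ξ *
            Complex.exp (2 * Real.pi * Complex.I * ((⟪x, ξ⟫ : ℝ) : ℂ))) := by
        rw [pdo, hF]
        congr 1 with ξ
        rw [testHat_apply, Finset.mul_sum, Finset.sum_mul]
        refine Finset.sum_congr rfl fun j hj => ?_
        rw [mul_left_comm, chingSymbol_mul_freqBumpS m he (Finset.mem_Ico.1 hj).1]
        have hpow : ((2:ℝ)^j)^(-s) = ((2:ℝ)^j)^(-(s+m)) * ((2:ℝ)^j)^m := by
          rw [← Real.rpow_add (by positivity)]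
          congr 1
          ring
        rw [hpow, Complex.ofReal_mul]
        ring
    _ = ∑ j ∈ Finset.Ico 2 (N+2), ((((2:ℝ)^j)^(-s) : ℝ) : ℂ) *
          (planeWave e ((2:ℝ)^j • x) *
            (FourierTransformInv.fourierInv (freqBumpS ((2:ℝ)^j • e)) : 𝓢(RD d, ℂ)) x) := by
        rw [integral_finsetSum _ fun j _ => (hint j).const_mul _]
        refine Finset.sum_congr rfl fun j _ => ?_
        rw [integral_const_mul, ← fourierInv_apply, mul_assoc]
    _ = _ := by
        simp only [planeWave_mul_fourierInv_freqBumpS]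
        rw [← Finset.sum_mul, Complex.ofReal_sum]

lemma LP_zero_fourierInv_freqBumpS_zero {d : ℕ} (D : LPData d) :
    LP D 0 (FourierTransformInv.fourierInv (freqBumpS (0 : RD d)) : 𝓢(RD d, ℂ)) 0 =
      ((∫ ξ, freqBump (0 : RD d) ξ : ℝ) : ℂ) := by
  rw [LP_fourierInv, ← integral_complex_ofReal]
  congr 1 with ξ
  rw [inner_zero_left, Complex.ofReal_zero, mul_zero, Complex.exp_zero, mul_one,
    ← freqBumpS_apply]
  by_cases h : freqBumpS 0 ξ = 0
  · rw [h, mul_zero]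
  · have := norm_sub_lt_of_freqBumpS_ne_zero h
    rw [sub_zero] at this
    rw [LPhat_zero_eq_one D (by linarith), one_mul]

lemma le_FinftyNormFun_pdo {d : ℕ} (D : LPData d) (m q : ℝ) {s : ℝ} (hs : s ≤ 0) {e : RD d}
    (he : ‖e‖ = 1) (N : ℕ) :
    ENNReal.ofReal (N * ∫ ξ, freqBump (0 : RD d) ξ) ≤ FinftyNormFun D s q
      (pdo (chingSymbol m e) (FourierTransformInv.fourierInv (testHat (s+m) e N))) := by
  have hI : 0 ≤ ∫ ξ, freqBump (0 : RD d) ξ := integral_nonneg fun ξ => (freqBump 0).nonneg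
  refine le_trans ?_ (le_add_of_nonneg_right zero_le)
  refine le_trans ?_ (le_iSup _ (0 : RD d))
  have hfun : pdo (chingSymbol m e) (FourierTransformInv.fourierInv (testHat (s+m) e N)) =
      fun x => ((∑ j ∈ Finset.Ico 2 (N+2), ((2:ℝ)^j)^(-s) : ℝ) : ℂ) *
        (FourierTransformInv.fourierInv (freqBumpS 0) : 𝓢(RD d, ℂ)) x :=
    funext (pdo_chingSymbol_testFunction m s he N)
  have hLP : LP D 0 (pdo (chingSymbol m e)
      (FourierTransformInv.fourierInv (testHat (s+m) e N))) 0 =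
      (((∑ j ∈ Finset.Ico 2 (N+2), ((2:ℝ)^j)^(-s)) * ∫ ξ, freqBump (0 : RD d) ξ : ℝ) : ℂ) := by
    rw [Complex.ofReal_mul, ← LP_zero_fourierInv_freqBumpS_zero D, hfun, LP, LP,
      ← integral_const_mul]
    congr 1 with y
    ring
  have hsum : (N:ℝ) ≤ ∑ j ∈ Finset.Ico 2 (N+2), ((2:ℝ)^j)^(-s) := by
    calc (N:ℝ) = ∑ j ∈ Finset.Ico 2 (N+2), (1:ℝ) := by simp
      _ ≤ _ := Finset.sum_le_sum fun j _ =>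
        Real.one_le_rpow (one_le_pow₀ (by norm_num)) (by linarith)
  rw [hLP, ← ENNReal.ofReal_coe_nnreal, coe_nnnorm, Complex.norm_real]
  apply ENNReal.ofReal_le_ofReal
  refine le_trans ?_ (le_abs_self _)
  gcongr

lemma volume_dyadicCube {d : ℕ} (μ : ℕ) (n : Fin d → ℤ) :
    (2:ℝ≥0∞)^((μ:ℝ)*(d:ℝ)) * volume (dyadicCube d μ n) = 1 := by
  have hset : dyadicCube d μ n = (@WithLp.ofLp 2 (Fin d → ℝ)) ⁻¹' (Set.univ.pi fun i =>
      Set.Ico ((n i : ℝ) * (2:ℝ)^(-(μ:ℤ))) (((n i : ℝ) + 1) * (2:ℝ)^(-(μ:ℤ)))) := by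
    ext x
    simp [dyadicCube]
  rw [hset, (PiLp.volume_preserving_ofLp (Fin d)).measure_preimage
    (MeasurableSet.univ_pi fun i => measurableSet_Ico).nullMeasurableSet, volume_pi_pi]
  have hside : ∀ i, volume (Set.Ico ((n i : ℝ) * (2:ℝ)^(-(μ:ℤ)))
      (((n i : ℝ) + 1) * (2:ℝ)^(-(μ:ℤ)))) = ((2:ℝ≥0∞)^μ)⁻¹ := by
    intro i
    rw [Real.volume_Ico, ← sub_mul, add_sub_cancel_left, one_mul, zpow_neg, zpow_natCast,
      ENNReal.ofReal_inv_of_pos (by positivity), ENNReal.ofReal_pow (by norm_num),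
      ENNReal.ofReal_ofNat]
  rw [Finset.prod_congr rfl fun i _ => hside i, Finset.prod_const, Finset.card_univ,
    Fintype.card_fin, ENNReal.rpow_mul, ENNReal.rpow_natCast, ENNReal.rpow_natCast,
    ← ENNReal.inv_pow]
  exact ENNReal.mul_inv_cancel (by positivity) (by finiteness)

lemma cubePiece_le {d : ℕ} {σ q : ℝ} (hq : 0 < q) {K : ℝ} {J : ℕ} {g : ℕ → RD d → ℂ}
    (hg : ∀ (k : ℕ) x, (2:ℝ)^(σ*k) * ‖g k x‖ ≤ K) (hg0 : ∀ k x, J ≤ k → g k x = 0)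
    (μ : ℕ) (n : Fin d → ℤ) :
    cubePiece d μ n μ σ q g ≤ (J:ℝ≥0∞)^(1/q) * ENNReal.ofReal K := by
  have hterm : ∀ (k : ℕ) (x : RD d),
      (2:ℝ≥0∞)^(σ*(k:ℝ)*q) * (‖g k x‖₊ : ℝ≥0∞)^q ≤ ENNReal.ofReal K ^ q := by
    intro k x
    rw [ENNReal.rpow_mul, ← ENNReal.mul_rpow_of_nonneg _ _ hq.le]
    refine ENNReal.rpow_le_rpow ?_ hq.le
    refine le_trans (le_of_eq ?_) (ENNReal.ofReal_le_ofReal (hg k x))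
    rw [ENNReal.ofReal_mul (by positivity), ← ENNReal.ofReal_rpow_of_pos (by norm_num),
      ENNReal.ofReal_ofNat, ← ENNReal.ofReal_coe_nnreal, coe_nnnorm]
  have hsum : ∀ x : RD d, ∑' j : ℕ, (2:ℝ≥0∞)^(σ*((μ:ℝ)+(j:ℝ))*q) * (‖g (μ+j) x‖₊ : ℝ≥0∞)^q
      ≤ J * ENNReal.ofReal K ^ q := by
    intro x
    rw [tsum_eq_sum (s := Finset.range J)]
    · calc _ ≤ ∑ j ∈ Finset.range J, ENNReal.ofReal K ^ q := by
            refine Finset.sum_le_sum fun j _ => ?_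
            have := hterm (μ + j) x
            rwa [Nat.cast_add] at this
        _ = _ := by simp
    · intro j hj
      rw [Finset.mem_range, not_lt] at hj
      rw [hg0 _ _ (by omega), nnnorm_zero, ENNReal.coe_zero, ENNReal.zero_rpow_of_pos hq, mul_zero]
  have hint : ∫⁻ x in dyadicCube d μ n,
      ∑' j : ℕ, (2:ℝ≥0∞)^(σ*((μ:ℝ)+(j:ℝ))*q) * (‖g (μ+j) x‖₊ : ℝ≥0∞)^q
      ≤ J * ENNReal.ofReal K ^ q * volume (dyadicCube d μ n) :=
    (lintegral_mono hsum).trans (by rw [setLIntegral_const])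
  calc cubePiece d μ n μ σ q g
      ≤ ((2:ℝ≥0∞)^((μ:ℝ)*(d:ℝ)) * (J * ENNReal.ofReal K ^ q * volume (dyadicCube d μ n)))^(1/q) :=
        ENNReal.rpow_le_rpow (by gcongr) (by positivity)
    _ = (J * ENNReal.ofReal K ^ q)^(1/q) := by
        rw [mul_left_comm, volume_dyadicCube, mul_one]
    _ = _ := by
        rw [ENNReal.mul_rpow_of_nonneg _ _ (by positivity), ← ENNReal.rpow_mul,
          mul_one_div_cancel hq.ne', ENNReal.rpow_one]

lemma exists_FinftyNormFun_testFunction_le {d : ℕ} (D : LPData d) (σ : ℝ) {q : ℝ} (hq : 0 < q)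
    {e : RD d} (he : ‖e‖ = 1) :
    ∃ K : ℝ, 0 ≤ K ∧ ∀ N : ℕ, FinftyNormFun D σ q
      (FourierTransformInv.fourierInv (testHat σ e N) : 𝓢(RD d, ℂ)) ≤
        ((N + 3 : ℕ) : ℝ≥0∞)^(1/q) * ENNReal.ofReal K := by
  obtain ⟨A, hA0, hA⟩ := exists_norm_LPhat_le D
  have hI : 0 ≤ ∫ ξ, freqBump (0 : RD d) ξ := integral_nonneg fun ξ => (freqBump 0).nonneg
  refine ⟨3 * (2^|σ| * (A * ∫ ξ, freqBump (0 : RD d) ξ)), by positivity, fun N => ?_⟩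
  have hzero : (⨆ x : RD d, (‖LP D 0
      (FourierTransformInv.fourierInv (testHat σ e N) : 𝓢(RD d, ℂ)) x‖₊ : ℝ≥0∞)) = 0 := by
    simp [LP_testFunction_eq_zero D he σ (Or.inl rfl)]
  rw [FinftyNormFun, hzero, zero_add]
  exact iSup_le fun μ => iSup_le fun _ => iSup_le fun n => cubePiece_le hq
    (norm_LP_testFunction_le D hA0 hA he σ N)
    (fun k x hk => LP_testFunction_eq_zero D he σ (Or.inr hk) x) μ n

lemma exists_nat_mul_rpow_lt {p : ℝ} (hp : p < 1) (C : ℝ) {I : ℝ} (hI : 0 < I) :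
    ∃ N : ℕ, C * ((N + 3 : ℕ) : ℝ)^p < N * I := by
  have hc : 0 < I / (4 * (|C| + 1)) := by positivity
  have hev := (tendsto_natCast_atTop_atTop (R := ℝ)).eventually ((tendsto_rpow_neg_atTop (sub_pos.2 hp)).eventually (gt_mem_nhds hc))
  obtain ⟨M, hM, hM4⟩ := (hev.and (eventually_ge_atTop 4)).exists
  obtain ⟨N, rfl⟩ : ∃ N, M = N + 3 := ⟨M - 3, by omega⟩
  refine ⟨N, ?_⟩
  have hN : (1:ℝ) ≤ N := by exact_mod_cast (by omega : 1 ≤ N)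
  have hN0 : (0:ℝ) < ((N + 3 : ℕ) : ℝ) := by positivity
  have hle : ((N + 3 : ℕ) : ℝ)^p ≤ I / (4 * (|C| + 1)) * ((N + 3 : ℕ) : ℝ) := by
    have hsplit : p = -(1 - p) + 1 := by ring
    rw [hsplit, Real.rpow_add_one hN0.ne']
    gcongr
  have hpos : (0:ℝ) < ((N + 3 : ℕ) : ℝ)^p := by positivity
  calc C * ((N + 3 : ℕ) : ℝ)^p < (|C| + 1) * ((N + 3 : ℕ) : ℝ)^p := by
        gcongr
        linarith [le_abs_self C]
    _ ≤ (|C| + 1) * (I / (4 * (|C| + 1)) * ((N + 3 : ℕ) : ℝ)) := by gcongr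
    _ = I * (N + 3) / 4 := by
        push_cast
        field_simp
    _ ≤ N * I := by nlinarith

/-- for `1 < q < ∞` and `s ≤ 0` there is `a ∈ S^m_{1,1}` unbounded from
`F_∞^{s+m,q}` to `F_∞^{s,q}`; hence `s > τ_q = 0` is sharp in this range. -/
theorem statement19 (d : ℕ) (hd : 1 ≤ d) (m : ℝ) (q : ℝ) (hq : 1 < q)
    (s : ℝ) (hs : s ≤ 0) (D : LPData d) :
    ∃ a : RD d → RD d → ℂ, IsSymbolS11 d m a ∧
      ∀ C : ℝ≥0, 0 < C → ∃ f : 𝓢(RD d, ℂ),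
        (C : ℝ≥0∞) * FinftyNormFun D (s+m) q (⇑f) < FinftyNormFun D s q (pdo a f) := by
  obtain ⟨e, he⟩ : ∃ e : RD d, ‖e‖ = 1 := ⟨EuclideanSpace.single ⟨0, hd⟩ 1, by simp⟩
  have hq0 : 0 < q := by linarith
  obtain ⟨K, hK0, hK⟩ := exists_FinftyNormFun_testFunction_le D (s+m) hq0 he
  refine ⟨chingSymbol m e, isSymbolS11_chingSymbol m he, fun C _ => ?_⟩
  have hI : 0 < ∫ ξ, freqBump (0 : RD d) ξ := (freqBump 0).integral_pos
  obtain ⟨N, hN⟩ := exists_nat_mul_rpow_lt (p := 1/q)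
    ((div_lt_one hq0).2 hq) (C * K) hI
  refine ⟨FourierTransformInv.fourierInv (testHat (s+m) e N), ?_⟩
  calc (C : ℝ≥0∞) * FinftyNormFun D (s+m) q
        (FourierTransformInv.fourierInv (testHat (s+m) e N) : 𝓢(RD d, ℂ))
      ≤ C * (((N + 3 : ℕ) : ℝ≥0∞)^(1/q) * ENNReal.ofReal K) := by
        gcongr
        exact hK N
    _ = ENNReal.ofReal (C * K * ((N + 3 : ℕ) : ℝ)^(1/q)) := by
        rw [ENNReal.ofReal_mul (by positivity), ENNReal.ofReal_mul C.coe_nonneg,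
          ENNReal.ofReal_coe_nnreal, ← ENNReal.ofReal_rpow_of_pos (by positivity),
          ENNReal.ofReal_natCast]
        ring
    _ < ENNReal.ofReal (N * ∫ ξ, freqBump (0 : RD d) ξ) :=
        (ENNReal.ofReal_lt_ofReal_iff_of_nonneg (by positivity)).2 hN
    _ ≤ _ := le_FinftyNormFun_pdo D m q hs he N

end
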